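/- arXiv:1210.6905 — 7 statements merged into one kernel-verified Lean document; each statement's English description precedes it below -/
import Mathlib

section
/- Every recursive maximal planar graph (Apollonian graph) has at least two vertices of degree 3; moreover, if it has at least 5 vertices, then no two of its vertices of degree 3 are adjacent. -/
/-- A recursive maximal planar graph (Apollonian graph): the smallest family of graphs
containing `K₄` and closed under adding a new vertex joined to the three mutually
adjacent vertices of a triangle. -/
inductive IsRecursiveMaximalPlanar : ∀ {n : ℕ}, SimpleGraph (Fin n) → Prop
  | base : IsRecursiveMaximalPlanar (⊤ : SimpleGraph (Fin 4))
  | extend {n : ℕ} (G : SimpleGraph (Fin n)) (a b c : Fin n)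
      (hG : IsRecursiveMaximalPlanar G)
      (hab : G.Adj a b) (hbc : G.Adj b c) (hac : G.Adj a c)
      (G' : SimpleGraph (Fin (n + 1)))
      (hold : ∀ u v : Fin n, G'.Adj u.castSucc v.castSucc ↔ G.Adj u v)
      (hnew : ∀ u : Fin n, G'.Adj (Fin.last n) u.castSucc ↔ (u = a ∨ u = b ∨ u = c)) :
      IsRecursiveMaximalPlanar G'

/-- A one-vertex extension adds the new vertex to the neighborhoods of `a`, `b`, `c` only. -/
theorem degree_castSucc_of_extension {n : ℕ} {G : SimpleGraph (Fin n)}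
    {G' : SimpleGraph (Fin (n + 1))} [DecidableRel G.Adj] [DecidableRel G'.Adj] {a b c : Fin n}
    (hold : ∀ u v : Fin n, G'.Adj u.castSucc v.castSucc ↔ G.Adj u v)
    (hnew : ∀ u : Fin n, G'.Adj (Fin.last n) u.castSucc ↔ (u = a ∨ u = b ∨ u = c)) (u : Fin n) :
    G'.degree u.castSucc = G.degree u + if u = a ∨ u = b ∨ u = c then 1 else 0 := by
  rw [← G'.card_neighborFinset_eq_degree, ← G.card_neighborFinset_eq_degree,
    G'.neighborFinset_eq_filter, G.neighborFinset_eq_filter,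
    Finset.card_filter, Finset.card_filter, Fin.sum_univ_castSucc]
  simp only [hold, G'.adj_comm _ (Fin.last n), hnew]

/-- The new vertex of a one-vertex extension over three distinct vertices has degree three. -/
theorem degree_last_of_extension {n : ℕ} {G' : SimpleGraph (Fin (n + 1))} [DecidableRel G'.Adj]
    {a b c : Fin n} (hab : a ≠ b) (hbc : b ≠ c) (hac : a ≠ c)
    (hnew : ∀ u : Fin n, G'.Adj (Fin.last n) u.castSucc ↔ (u = a ∨ u = b ∨ u = c)) :
    G'.degree (Fin.last n) = 3 := by
  rw [← G'.card_neighborFinset_eq_degree, G'.neighborFinset_eq_filter,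
    Finset.card_filter, Fin.sum_univ_castSucc]
  simp only [hnew, SimpleGraph.irrefl, if_false, add_zero]
  rw [← Finset.card_filter, ← Finset.card_eq_three.mpr ⟨a, b, c, hab, hac, hbc, rfl⟩]
  congr 1
  ext u
  simp

namespace IsRecursiveMaximalPlanar

theorem four_le {n : ℕ} {G : SimpleGraph (Fin n)} (h : IsRecursiveMaximalPlanar G) : 4 ≤ n := by
  induction h with
  | base => exact le_rfl
  | extend => omega

theorem degree_top_fin_four [DecidableRel (⊤ : SimpleGraph (Fin 4)).Adj] (u : Fin 4) :
    (⊤ : SimpleGraph (Fin 4)).degree u = 3 := by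
  convert SimpleGraph.complete_graph_degree u
  simp

theorem three_le_degree {n : ℕ} {G : SimpleGraph (Fin n)} [inst : DecidableRel G.Adj]
    (h : IsRecursiveMaximalPlanar G) (u : Fin n) : 3 ≤ G.degree u := by
  revert inst
  induction h with
  | base =>
    intro inst
    rw [degree_top_fin_four]
  | extend G a b c hG hab hbc hac G' hold hnew ih =>
    intro inst
    classical
    induction u using Fin.lastCases with
    | last => exact (degree_last_of_extension hab.ne hbc.ne hac.ne hnew).ge
    | cast u =>
      rw [degree_castSucc_of_extension hold hnew]
      exact (ih u).trans (Nat.le_add_right _ _)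

/-- In an extension, an old vertex has degree three exactly when it had degree three before
and is not a vertex of the chosen triangle. -/
theorem degree_castSucc_eq_three_iff {n : ℕ} {G : SimpleGraph (Fin n)}
    {G' : SimpleGraph (Fin (n + 1))} [DecidableRel G.Adj] [DecidableRel G'.Adj] {a b c : Fin n}
    (hG : IsRecursiveMaximalPlanar G)
    (hold : ∀ u v : Fin n, G'.Adj u.castSucc v.castSucc ↔ G.Adj u v)
    (hnew : ∀ u : Fin n, G'.Adj (Fin.last n) u.castSucc ↔ (u = a ∨ u = b ∨ u = c)) (u : Fin n) :
    G'.degree u.castSucc = 3 ↔ G.degree u = 3 ∧ ¬ (u = a ∨ u = b ∨ u = c) := by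
  have := hG.three_le_degree u
  rw [degree_castSucc_of_extension hold hnew]
  split_ifs with hu
  · simp only [hu, not_true, and_false, iff_false]
    omega
  · simp [hu]

theorem not_adj_of_degree_eq_three {n : ℕ} {G : SimpleGraph (Fin n)} [inst : DecidableRel G.Adj]
    (h : IsRecursiveMaximalPlanar G) (hn : 5 ≤ n) (u v : Fin n) (hu : G.degree u = 3)
    (hv : G.degree v = 3) : ¬ G.Adj u v := by
  revert inst
  induction h with
  | base => omega
  | @extend n G a b c hG hab hbc hac G' hold hnew ih =>
    intro inst hu hv
    classical
    have key := hG.degree_castSucc_eq_three_iff hold hnew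
    induction u using Fin.lastCases with
    | last =>
      induction v using Fin.lastCases with
      | last => exact G'.irrefl
      | cast v => exact fun hadj => ((key v).mp hv).2 ((hnew v).mp hadj)
    | cast u =>
      induction v using Fin.lastCases with
      | last => exact fun hadj => ((key u).mp hu).2 ((hnew u).mp hadj.symm)
      | cast v =>
        rw [key] at hu hv
        rw [hold]
        by_cases hn' : 5 ≤ n
        · exact ih hn' u v hu.1 hv.1
        · intro hadj
          have h₁ := hadj.ne
          have h₂ := hab.ne
          have h₃ := hbc.ne
          have h₄ := hac.ne
          have h₅ := hu.2
          have h₆ := hv.2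
          simp only [ne_eq, Fin.ext_iff] at h₁ h₂ h₃ h₄ h₅ h₆
          omega

theorem exists_two_degree_eq_three {n : ℕ} {G : SimpleGraph (Fin n)} [inst : DecidableRel G.Adj]
    (h : IsRecursiveMaximalPlanar G) :
    ∃ u v : Fin n, u ≠ v ∧ G.degree u = 3 ∧ G.degree v = 3 := by
  revert inst
  induction h with
  | base =>
    intro inst
    exact ⟨0, 1, Fin.zero_ne_one, degree_top_fin_four 0, degree_top_fin_four 1⟩
  | @extend n G a b c hG hab hbc hac G' hold hnew ih =>
    intro inst
    classical
    obtain ⟨u, hu⟩ : ∃ u, G.degree u = 3 ∧ ¬ (u = a ∨ u = b ∨ u = c) := by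
      by_cases hn : 5 ≤ n
      · obtain ⟨u, v, huv, hu, hv⟩ := ih
        have hadj := hG.not_adj_of_degree_eq_three hn u v hu hv
        by_contra! hcon
        rcases hcon u hu with rfl | rfl | rfl <;> rcases hcon v hv with rfl | rfl | rfl <;>
          simp_all [G.adj_comm]
      · have hn4 : n = 4 := by have := hG.four_le; omega
        obtain ⟨u, hu⟩ : ∃ u, u ∉ ({a, b, c} : Finset (Fin n)) := by
          by_contra! hcon
          have hcard := Finset.card_le_three (a := a) (b := b) (c := c)
          rw [Finset.eq_univ_iff_forall.mpr hcon, Finset.card_univ, Fintype.card_fin] at hcard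
          omega
        have hlt := G.degree_lt_card_verts u
        rw [Fintype.card_fin] at hlt
        have hle := hG.three_le_degree u
        exact ⟨u, by omega, by simpa using hu⟩
    exact ⟨Fin.last n, u.castSucc, (Fin.castSucc_lt_last u).ne',
      degree_last_of_extension hab.ne hbc.ne hac.ne hnew,
      (hG.degree_castSucc_eq_three_iff hold hnew u).mpr hu⟩

end IsRecursiveMaximalPlanar

/-- Every recursive maximal planar graph has at least two vertices of
degree 3; moreover, if it has at least 5 vertices, then no two of its vertices of
degree 3 are adjacent. -/
theorem statement1 {n : ℕ} (G : SimpleGraph (Fin n)) [DecidableRel G.Adj]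
    (h : IsRecursiveMaximalPlanar G) :
    (∃ u v : Fin n, u ≠ v ∧ G.degree u = 3 ∧ G.degree v = 3) ∧
      (5 ≤ n → ∀ u v : Fin n, G.degree u = 3 → G.degree v = 3 → ¬ G.Adj u v) := by
  exact ⟨h.exists_two_degree_eq_three, h.not_adj_of_degree_eq_three⟩
end

section
/- Every recursive maximal planar graph (Apollonian graph) G is uniquely 4-colorable: G has chromatic number 4, and any two proper 4-colorings of G induce the same partition of the vertex set of G into four color classes. -/
theorem Fin.eq_iff_ne_of_ne {x y p q r : Fin 4} (hpq : p ≠ q) (hqr : q ≠ r) (hpr : p ≠ r)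
    (hp : x ≠ p) (hq : x ≠ q) (hr : x ≠ r) : y = x ↔ y ≠ p ∧ y ≠ q ∧ y ≠ r := by
  omega

theorem Fin.exists_ne_and_ne_and_ne (p q r : Fin 4) : ∃ x : Fin 4, x ≠ p ∧ x ≠ q ∧ x ≠ r := by
  revert p q r
  decide

namespace IsRecursiveMaximalPlanar

theorem not_cliqueFree {n : ℕ} {G : SimpleGraph (Fin n)} (h : IsRecursiveMaximalPlanar G) :
    ¬ G.CliqueFree 4 := by
  induction h with
  | base => exact SimpleGraph.IsContained.not_cliqueFree (SimpleGraph.IsContained.refl _)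
  | extend G a b c hG hab hbc hac G' hold hnew ih =>
    intro hfree
    let e : G ↪g G' := ⟨Fin.castSuccEmb, fun {u v} => hold u v⟩
    exact ih (hfree.comap ⟨e.toCopy⟩)

theorem colorable {n : ℕ} {G : SimpleGraph (Fin n)} (h : IsRecursiveMaximalPlanar G) :
    G.Colorable 4 := by
  induction h with
  | base => exact ⟨SimpleGraph.selfColoring _⟩
  | extend G a b c hG hab hbc hac G' hold hnew ih =>
    obtain ⟨C⟩ := ih
    obtain ⟨x, ha, hb, hc⟩ := Fin.exists_ne_and_ne_and_ne (C a) (C b) (C c)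
    have hx : ∀ u, G'.Adj (Fin.last _) u.castSucc → x ≠ C u := by
      intro u hu
      rcases (hnew u).1 hu with rfl | rfl | rfl <;> assumption
    refine ⟨SimpleGraph.Coloring.mk (Fin.lastCases x C) ?_⟩
    intro u v huv
    induction u using Fin.lastCases with
    | last =>
      induction v using Fin.lastCases with
      | last => exact absurd huv (G'.irrefl)
      | cast v => simpa using hx v huv
    | cast u =>
      induction v using Fin.lastCases with
      | last => simpa using (hx u huv.symm).symm
      | cast v => simpa using C.valid ((hold u v).1 huv)

theorem chromaticNumber_eq {n : ℕ} {G : SimpleGraph (Fin n)} (h : IsRecursiveMaximalPlanar G) :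
    G.chromaticNumber = 4 := by
  refine le_antisymm h.colorable.chromaticNumber_le ?_
  obtain ⟨s, hs⟩ := not_forall_not.1 h.not_cliqueFree
  have := hs.isClique.card_le_chromaticNumber
  rwa [hs.card_eq] at this

theorem eq_iff_eq_of_proper {n : ℕ} {G : SimpleGraph (Fin n)} (h : IsRecursiveMaximalPlanar G)
    (f g : Fin n → Fin 4) (hf : ∀ ⦃u v : Fin n⦄, G.Adj u v → f u ≠ f v)
    (hg : ∀ ⦃u v : Fin n⦄, G.Adj u v → g u ≠ g v) (u v : Fin n) : f u = f v ↔ g u = g v := by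
  induction h with
  | base =>
    rcases eq_or_ne u v with rfl | huv
    · simp
    · exact iff_of_false (hf huv) (hg huv)
  | @extend n G a b c hG hab hbc hac G' hold hnew ih =>
    have hold_eq := ih (fun u => f u.castSucc) (fun u => g u.castSucc)
      (fun u v huv => hf ((hold u v).2 huv)) (fun u v huv => hg ((hold u v).2 huv))
    have eq_last : ∀ k : Fin (n + 1) → Fin 4, (∀ ⦃u v⦄, G'.Adj u v → k u ≠ k v) →
        ∀ v : Fin n, k v.castSucc = k (Fin.last n) ↔ k v.castSucc ≠ k a.castSucc ∧
          k v.castSucc ≠ k b.castSucc ∧ k v.castSucc ≠ k c.castSucc := fun k hk v =>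
      Fin.eq_iff_ne_of_ne (hk ((hold a b).2 hab)) (hk ((hold b c).2 hbc)) (hk ((hold a c).2 hac))
        (hk ((hnew a).2 (by simp))) (hk ((hnew b).2 (by simp))) (hk ((hnew c).2 (by simp)))
    have hlast : ∀ v : Fin n, f v.castSucc = f (Fin.last n) ↔ g v.castSucc = g (Fin.last n) := by
      intro v
      rw [eq_last f hf, eq_last g hg]
      exact and_congr (not_congr (hold_eq v a))
        (and_congr (not_congr (hold_eq v b)) (not_congr (hold_eq v c)))
    induction u using Fin.lastCases with
    | last =>
      induction v using Fin.lastCases with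
      | last => simp
      | cast v => rw [eq_comm, hlast, eq_comm]
    | cast u =>
      induction v using Fin.lastCases with
      | last => exact hlast u
      | cast v => exact hold_eq u v

end IsRecursiveMaximalPlanar

/-- Every recursive maximal planar graph is uniquely 4-colorable: it has
chromatic number 4 and any two proper 4-colorings induce the same partition of the
vertex set into color classes. -/
theorem statement2 {n : ℕ} (G : SimpleGraph (Fin n)) (h : IsRecursiveMaximalPlanar G) :
    G.chromaticNumber = 4 ∧
      ∀ f g : Fin n → Fin 4,
        (∀ ⦃u v : Fin n⦄, G.Adj u v → f u ≠ f v) →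
        (∀ ⦃u v : Fin n⦄, G.Adj u v → g u ≠ g v) →
        ∀ u v : Fin n, f u = f v ↔ g u = g v :=
  ⟨h.chromaticNumber_eq, h.eq_iff_eq_of_proper⟩
end

section
/- Every recursive maximal planar graph (Apollonian graph) is a pure tree-coloring graph: for every proper 4-coloring f of such a graph G and every pair of distinct colors i, j, the subgraph of G induced by the set of vertices colored i or j contains no cycle. -/
/-- The smaller neighbours of a vertex of a recursive maximal planar graph are mutually adjacent:
reversing the order of the vertices gives a perfect elimination ordering. -/
theorem IsRecursiveMaximalPlanar.adj_of_lt {n : ℕ} {G : SimpleGraph (Fin n)}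
    (h : IsRecursiveMaximalPlanar G) :
    ∀ {u v w : Fin n}, G.Adj v u → G.Adj v w → u < v → w < v → u ≠ w → G.Adj u w := by
  induction h with
  | base => intro u v w _ _ _ _ huw; exact huw
  | extend G a b c _ hab hbc hac G' hold hnew ih =>
    intro u v w hvu hvw huv hwv huw
    obtain ⟨u, rfl⟩ := Fin.exists_castSucc_eq.2 (huv.trans_le (Fin.le_last v)).ne
    obtain ⟨w, rfl⟩ := Fin.exists_castSucc_eq.2 (hwv.trans_le (Fin.le_last v)).ne
    rw [hold]
    induction v using Fin.lastCases with
    | last =>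
      rw [hnew] at hvu hvw
      rcases hvu with rfl | rfl | rfl <;> rcases hvw with rfl | rfl | rfl <;>
        first | exact absurd rfl huw | assumption | (apply SimpleGraph.Adj.symm; assumption)
    | cast v =>
      rw [hold] at hvu hvw
      exact ih hvu hvw huv hwv fun e => huw (e ▸ rfl)

/-- A graph on a linear order is acyclic if every vertex has at most one smaller neighbour. -/
theorem SimpleGraph.isAcyclic_of_subsingleton_lt_neighbors {V : Type*} [LinearOrder V]
    {G : SimpleGraph V}
    (h : ∀ ⦃u v w : V⦄, G.Adj v u → G.Adj v w → u < v → w < v → u = w) : G.IsAcyclic := by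
  intro x c hc
  obtain ⟨v, hv, hmax⟩ := c.support.toFinset.exists_max_image id ⟨x, by simp⟩
  rw [List.mem_toFinset] at hv
  have hr := hc.rotate hv
  have hlt : ∀ u ∈ (c.rotate v hv).support, G.Adj v u → u < v := fun u hu huv =>
    lt_of_le_of_ne (hmax u (by simpa using hu)) huv.ne'
  have hsnd := (c.rotate v hv).adj_snd hr.not_nil
  have hpen := ((c.rotate v hv).adj_penultimate hr.not_nil).symm
  exact hr.snd_ne_penultimate (h hsnd hpen
    (hlt _ (SimpleGraph.Walk.getVert_mem_support _ _) hsnd)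
    (hlt _ (SimpleGraph.Walk.getVert_mem_support _ _) hpen))

/-- Every recursive maximal planar graph is a pure tree-coloring graph:
for every proper 4-coloring `f` and every pair of distinct colors `i, j`, the subgraph
induced by the vertices colored `i` or `j` contains no cycle. -/
theorem statement3 {n : ℕ} (G : SimpleGraph (Fin n)) (h : IsRecursiveMaximalPlanar G)
    (f : Fin n → Fin 4) (hf : ∀ ⦃u v : Fin n⦄, G.Adj u v → f u ≠ f v)
    (i j : Fin 4) (hij : i ≠ j) :
    (G.induce {v : Fin n | f v = i ∨ f v = j}).IsAcyclic := by
  refine SimpleGraph.isAcyclic_of_subsingleton_lt_neighbors ?_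
  rintro ⟨u, hu⟩ ⟨v, hv⟩ ⟨w, hw⟩ hvu hvw huv hwv
  by_contra huw
  have hvu : G.Adj v u := hvu
  have hvw : G.Adj v w := hvw
  have hadj := h.adj_of_lt hvu hvw huv hwv fun e => huw (Subtype.ext e)
  have h₁ := hf hvu
  have h₂ := hf hvw
  have h₃ := hf hadj
  simp only [Set.mem_ofPred_eq] at hu hv hw
  grind
end

section
/- Let n ≥ 4 and let G be the double-center wheel obtained by joining a cycle C_n with two nonadjacent extra vertices. Then G is a pure cycle-coloring graph: every proper 4-coloring f of G has a bicolored cycle, i.e., a cycle of G on whose vertices f takes exactly two values. -/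
/-- The double-center wheel: the join of the cycle `Cₙ` (on the vertices `Sum.inl i`,
with `i : ZMod n`, joined cyclically) with two nonadjacent extra vertices
(`Sum.inr 0` and `Sum.inr 1`). -/
def doubleWheel (n : ℕ) : SimpleGraph (ZMod n ⊕ Fin 2) :=
  SimpleGraph.fromRel fun x y =>
    match x, y with
    | Sum.inl i, Sum.inl j => j = i + 1
    | Sum.inl _, Sum.inr _ => True
    | Sum.inr _, Sum.inl _ => False
    | Sum.inr _, Sum.inr _ => False

/-- If the colors met by a cycle of a properly colored graph lie in a set of at most two colors,
then the cycle meets exactly two colors. -/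
theorem SimpleGraph.Walk.IsCycle.card_colors_eq_two {V α : Type*} [DecidableEq α]
    {G : SimpleGraph V} {f : V → α} (hf : ∀ ⦃u v : V⦄, G.Adj u v → f u ≠ f v)
    {x : V} {c : G.Walk x x} (hc : c.IsCycle) (S : Finset α) (hS : S.card ≤ 2)
    (hcS : ∀ y ∈ c.support, f y ∈ S) :
    (c.support.map f).toFinset.card = 2 := by
  apply le_antisymm
  · refine (Finset.card_le_card fun a ha => ?_).trans hS
    simp only [List.mem_toFinset, List.mem_map] at ha
    obtain ⟨y, hy, rfl⟩ := ha
    exact hcS y hy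
  · refine Finset.one_lt_card.mpr ⟨f x, ?_, f c.snd, ?_, hf (c.adj_snd hc.not_nil)⟩
    · exact List.mem_toFinset.mpr (List.mem_map_of_mem c.start_mem_support)
    · exact List.mem_toFinset.mpr (List.mem_map_of_mem (c.getVert_mem_support 1))

theorem doubleWheel_adj_inl_inr (n : ℕ) (i : ZMod n) (k : Fin 2) :
    (doubleWheel n).Adj (Sum.inl i) (Sum.inr k) := by
  simp [doubleWheel]

/-- The rim of the double-center wheel is a copy of the cycle graph. -/
def doubleWheelRim (m : ℕ) : SimpleGraph.cycleGraph (m + 3) →g doubleWheel (m + 3) where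
  toFun i := Sum.inl (i : ZMod (m + 3))
  map_rel' := by
    intro a b h
    have hne : a ≠ b := h.ne
    rw [SimpleGraph.cycleGraph_adj] at h
    rw [doubleWheel, SimpleGraph.fromRel_adj]
    refine ⟨fun h' => hne (Sum.inl_injective h'), ?_⟩
    rcases h with h | h
    · exact Or.inr (sub_eq_iff_eq_add'.mp h)
    · exact Or.inl (sub_eq_iff_eq_add'.mp h)

theorem doubleWheelRim_injective (m : ℕ) : Function.Injective (doubleWheelRim m) :=
  fun _ _ h => Sum.inl_injective h

/-- The 4-cycle through both centers and two distinct rim vertices. -/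
theorem doubleWheel_exists_isCycle (n : ℕ) {i j : ZMod n} (hij : i ≠ j) :
    ∃ c : (doubleWheel n).Walk (Sum.inr 0) (Sum.inr 0),
      c.IsCycle ∧ c.support = [Sum.inr 0, Sum.inl i, Sum.inr 1, Sum.inl j, Sum.inr 0] := by
  refine ⟨.cons (doubleWheel_adj_inl_inr n i 0).symm <| .cons (doubleWheel_adj_inl_inr n i 1) <|
    .cons (doubleWheel_adj_inl_inr n j 1).symm <| .cons (doubleWheel_adj_inl_inr n j 0) .nil,
    ?_, by simp⟩
  rw [SimpleGraph.Walk.cons_isCycle_iff]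
  simp [SimpleGraph.Walk.cons_isPath_iff, hij]

/-- For `n ≥ 4`, the double-center wheel obtained by joining a cycle `Cₙ`
with two nonadjacent extra vertices is a pure cycle-coloring graph: every proper
4-coloring has a bicolored cycle, i.e. a cycle on whose vertices the coloring takes
exactly two values. -/
theorem statement4 (n : ℕ) (hn : 4 ≤ n)
    (f : ZMod n ⊕ Fin 2 → Fin 4)
    (hf : ∀ ⦃u v : ZMod n ⊕ Fin 2⦄, (doubleWheel n).Adj u v → f u ≠ f v) :
    ∃ (x : ZMod n ⊕ Fin 2) (c : (doubleWheel n).Walk x x),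
      c.IsCycle ∧ (c.support.map f).toFinset.card = 2 := by
  have hpos : 3 ≤ n := by omega
  have hcenter (i : ZMod n) (k : Fin 2) : f (Sum.inl i) ≠ f (Sum.inr k) :=
    hf (doubleWheel_adj_inl_inr n i k)
  by_cases hcol : f (Sum.inr 0) = f (Sum.inr 1)
  · have : NeZero n := ⟨by omega⟩
    obtain ⟨i, -, j, -, hij, hfij⟩ : ∃ i ∈ (Finset.univ : Finset (ZMod n)),
        ∃ j ∈ (Finset.univ : Finset (ZMod n)), i ≠ j ∧ f (Sum.inl i) = f (Sum.inl j) := by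
      refine Finset.exists_ne_map_eq_of_card_lt_of_maps_to
        (t := Finset.univ.erase (f (Sum.inr 0))) ?_ fun i _ => ?_
      · rw [Finset.card_erase_of_mem (Finset.mem_univ _)]
        simp only [Finset.card_univ, Fintype.card_fin, ZMod.card]
        omega
      · simpa using hcenter i 0
    obtain ⟨c, hc, hsupp⟩ := doubleWheel_exists_isCycle n hij
    refine ⟨_, c, hc, hc.card_colors_eq_two hf {f (Sum.inr 0), f (Sum.inl i)}
      Finset.card_le_two ?_⟩
    simp [hsupp, ← hcol, ← hfij]
  · obtain ⟨m, rfl⟩ := Nat.exists_eq_add_of_le' hpos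
    have hc := (SimpleGraph.cycleGraph.isCycle_cycle (n := m)).map (doubleWheelRim_injective m)
    refine ⟨_, _, hc, hc.card_colors_eq_two hf
      ((Finset.univ.erase (f (Sum.inr 0))).erase (f (Sum.inr 1))) ?_ ?_⟩
    · rw [Finset.card_erase_of_mem (by simpa using Ne.symm hcol),
        Finset.card_erase_of_mem (Finset.mem_univ _)]
      simp
    · intro y hy
      rw [SimpleGraph.Walk.support_map, List.mem_map] at hy
      obtain ⟨i, -, rfl⟩ := hy
      simp only [Finset.mem_erase, Finset.mem_univ, and_true]
      exact ⟨hcenter i 1, hcenter i 0⟩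
end

section
/- Let G be a simple graph with a proper vertex coloring f and let 1, 2, 3 be three pairwise distinct colors. Let C be a cycle of G all of whose edges have endpoint-color pairs among {1,2}, {1,3}, {2,3}, and suppose the edges of C with color pair {2,3} form a single consecutive subpath P of C of length p ≥ 0. Then the length of C is congruent to p modulo 2; in particular, if p is odd then C is an odd cycle, and if p is even then C is an even cycle. -/
namespace SimpleGraph.Walk

variable {V : Type*} {G : SimpleGraph V} {u v : V}

/-- A predicate that agrees at the two ends of every edge of a walk agrees at the two ends
of the walk. -/
theorem iff_of_forall_edges_iff (p : V → Prop) (W : G.Walk u v)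
    (h : ∀ a b, s(a, b) ∈ W.edges → (p a ↔ p b)) : p u ↔ p v := by
  induction W with
  | nil => rfl
  | cons hadj W ih =>
    exact (h _ _ (by simp)).trans (ih fun a b hab => h a b (by simp [hab]))

/-- If a predicate changes along every edge of a walk, then the walk has even length exactly
when the predicate agrees at its two ends. -/
theorem even_length_iff_of_forall_edges_not_iff (p : V → Prop) (W : G.Walk u v)
    (h : ∀ a b, s(a, b) ∈ W.edges → ¬(p a ↔ p b)) : Even W.length ↔ (p u ↔ p v) := by
  induction W with
  | nil => simp
  | cons hadj W ih =>
    have hhead := h _ _ (List.mem_cons_self : _ ∈ (cons hadj W).edges)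
    have htail := ih fun a b hab => h a b (by simp [hab])
    rw [length_cons, Nat.even_add_one]
    tauto

end SimpleGraph.Walk

/-- Let `C = P.append Q` be a cycle of `G` such that all edges of the
subpath `P` have endpoint-color pair `{c₂, c₃}` and all edges of `Q` have endpoint-color
pair `{c₁, c₂}` or `{c₁, c₃}` (so the `{c₂,c₃}`-edges of `C` form the single consecutive
subpath `P`, of length `p = P.length`). Then the length of `C` is congruent to `p`
modulo 2. -/
theorem statement8 {V α : Type*} (G : SimpleGraph V) (f : V → α)
    (hf : ∀ ⦃u v : V⦄, G.Adj u v → f u ≠ f v)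
    (c₁ c₂ c₃ : α) (h12 : c₁ ≠ c₂) (h13 : c₁ ≠ c₃) (h23 : c₂ ≠ c₃)
    (x y : V) (P : G.Walk x y) (Q : G.Walk y x)
    (hcyc : (P.append Q).IsCycle)
    (hP : ∀ e ∈ P.edges, Sym2.map f e = s(c₂, c₃))
    (hQ : ∀ e ∈ Q.edges, Sym2.map f e = s(c₁, c₂) ∨ Sym2.map f e = s(c₁, c₃)) :
    (P.append Q).length % 2 = P.length % 2 := by
  have hxy : f x = c₁ ↔ f y = c₁ := by
    refine P.iff_of_forall_edges_iff (f · = c₁) fun a b hab => ?_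
    have := hP _ hab
    rw [Sym2.map_mk, Sym2.eq_iff] at this
    grind
  have hQeven : Even Q.length := by
    refine (Q.even_length_iff_of_forall_edges_not_iff (f · = c₁) fun a b hab => ?_).2 hxy.symm
    have := hQ _ hab
    rw [Sym2.map_mk, Sym2.eq_iff, Sym2.eq_iff] at this
    grind
  rw [SimpleGraph.Walk.length_append]
  grind
end

section
/- Let G be a finite simple graph and let C be an induced cycle of G of even length 2m (m ≥ 2) with vertices v_1, v_2, …, v_{2m} in cyclic order. Suppose that every vertex of G not on C that has a neighbor on C is adjacent both to some odd-indexed vertex and to some even-indexed vertex of C, and suppose that the set Γ*(C) of all such vertices induces a cycle C* in G. Then G admits a proper 4-coloring in which exactly two colors appear on the vertices of C if and only if the graph G − V(C) admits a proper 4-coloring in which exactly two colors appear on the vertices of C*. -/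
theorem ZMod.even_val_add_one {m : ℕ} (hm : m ≠ 0) (i : ZMod (2 * m)) :
    Even (i + 1).val ↔ ¬ Even i.val := by
  have : NeZero (2 * m) := ⟨by lia⟩
  have : Fact (1 < 2 * m) := ⟨by lia⟩
  rw [ZMod.val_add, ZMod.val_one, Nat.even_iff, Nat.mod_mod_of_dvd _ (Dvd.intro _ rfl),
    ← Nat.even_iff, Nat.even_add_one]

theorem Set.ncard_compl_eq_two_of_fin_four {S : Set (Fin 4)} (hS : S.ncard = 2) :
    Sᶜ.ncard = 2 := by
  have h := Set.ncard_add_ncard_compl S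
  rw [Nat.card_fin] at h
  lia

/-- A proper coloring of an even cycle that takes only two values alternates. -/
theorem ZMod.alternating_of_ncard_eq_two {α : Type*} {m : ℕ} (hm : m ≠ 0)
    (c : ZMod (2 * m) → α) (hc : ∀ i, c i ≠ c (i + 1)) (h2 : (Set.range c).ncard = 2)
    (i : ZMod (2 * m)) : c i = if Even i.val then c 0 else c 1 := by
  have : NeZero (2 * m) := ⟨by lia⟩
  have : Fact (1 < 2 * m) := ⟨by lia⟩
  obtain ⟨a, b, -, hab⟩ := Set.ncard_eq_two.mp h2
  have hmem : ∀ j, c j = a ∨ c j = b := fun j ↦ by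
    simpa [hab] using Set.mem_range_self (f := c) j
  have hstep : ∀ j, c (j + 1 + 1) = c j := fun j ↦ by
    have h0 := hmem j
    have h1 := hmem (j + 1)
    have h2 := hmem (j + 1 + 1)
    have h01 := hc j
    have h12 := hc (j + 1)
    grind
  have key : ∀ n : ℕ, c (n : ZMod (2 * m)) = (if Even n then c 0 else c 1) ∧
      c ((n : ZMod (2 * m)) + 1) = if Even n then c 1 else c 0 := by
    intro n
    induction n with
    | zero => simp
    | succ n ih =>
      push_cast
      rw [hstep, ih.1, ih.2]
      by_cases h : Even n <;> simp [Nat.even_add_one, h]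
  simpa using (key i.val).1


/-- Let `C` be an induced even cycle `v : ZMod (2*m) → V` of `G` (`m ≥ 2`).
Suppose every vertex outside `C` with a neighbor on `C` is adjacent both to an
odd-indexed and to an even-indexed vertex of `C`, and that the set `Γstar` of all such
vertices induces a cycle `C*` (given by `w : ZMod k → V`). Then `G` has a proper
4-coloring using exactly two colors on `C` iff `G - V(C)` has a proper 4-coloring using
exactly two colors on `C*`. -/
theorem statement9 {V : Type*} [Fintype V] (G : SimpleGraph V)
    (m : ℕ) (hm : 2 ≤ m)
    (v : ZMod (2 * m) → V) (hv : Function.Injective v)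
    (hcyc : ∀ i j : ZMod (2 * m), G.Adj (v i) (v j) ↔ (j = i + 1 ∨ i = j + 1))
    (Γstar : Set V)
    (hΓ : Γstar = {x | x ∉ Set.range v ∧
        (∃ i : ZMod (2 * m), Even i.val ∧ G.Adj x (v i)) ∧
        (∃ j : ZMod (2 * m), ¬ Even j.val ∧ G.Adj x (v j))})
    (hnb : ∀ x : V, x ∉ Set.range v → (∃ i : ZMod (2 * m), G.Adj x (v i)) → x ∈ Γstar)
    (k : ℕ) (hk : 3 ≤ k) (w : ZMod k → V) (hw : Function.Injective w)
    (hwrange : Set.range w = Γstar)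
    (hwcyc : ∀ i j : ZMod k, G.Adj (w i) (w j) ↔ (j = i + 1 ∨ i = j + 1)) :
    (∃ f : V → Fin 4, (∀ ⦃a b : V⦄, G.Adj a b → f a ≠ f b) ∧
        (f '' Set.range v).ncard = 2) ↔
      (∃ g : ((Set.range v)ᶜ : Set V) → Fin 4,
        (∀ ⦃a b : ((Set.range v)ᶜ : Set V)⦄,
            (G.induce ((Set.range v)ᶜ)).Adj a b → g a ≠ g b) ∧
        (g '' {a : ((Set.range v)ᶜ : Set V) | (a : V) ∈ Γstar}).ncard = 2) := by
  have hm0 : m ≠ 0 := by lia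
  have : NeZero (2 * m) := ⟨by lia⟩
  have : Fact (1 < 2 * m) := ⟨by lia⟩
  have hΓmem : ∀ x, x ∈ Γstar ↔ x ∉ Set.range v ∧
      (∃ i : ZMod (2 * m), Even i.val ∧ G.Adj x (v i)) ∧
      (∃ j : ZMod (2 * m), ¬ Even j.val ∧ G.Adj x (v j)) := fun x ↦ by rw [hΓ]; rfl
  constructor
  · rintro ⟨f, hf, hf2⟩
    refine ⟨fun a ↦ f a, fun a b hab ↦ hf hab, ?_⟩
    have halt := ZMod.alternating_of_ncard_eq_two hm0 (f ∘ v)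
      (fun i ↦ hf ((hcyc _ _).mpr (Or.inl rfl))) (by rwa [Set.range_comp])
    have hsub : (fun a : ((Set.range v)ᶜ : Set V) ↦ f a) '' {a | (a : V) ∈ Γstar} ⊆
        (f '' Set.range v)ᶜ := by
      rintro _ ⟨x, hx, rfl⟩ ⟨_, ⟨l, rfl⟩, hl⟩
      obtain ⟨-, ⟨i, hi, hxi⟩, ⟨j, hj, hxj⟩⟩ := (hΓmem _).mp hx
      have hi' := halt i
      have hj' := halt j
      have hl' := halt l
      have hfi := hf hxi
      have hfj := hf hxj
      simp only [Function.comp_apply] at hi' hj' hl'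
      grind
    have hle := Set.ncard_le_ncard hsub
    rw [Set.ncard_compl_eq_two_of_fin_four hf2] at hle
    have hmem : ∀ i, f (w i) ∈
        (fun a : ((Set.range v)ᶜ : Set V) ↦ f a) '' {a | (a : V) ∈ Γstar} := fun i ↦
      have hi : w i ∈ Γstar := hwrange ▸ Set.mem_range_self i
      ⟨⟨w i, ((hΓmem _).mp hi).1⟩, hi, rfl⟩
    have hadj : G.Adj (w 0) (w 1) := (hwcyc 0 1).mpr (Or.inl (by simp))
    have hlt := (Set.one_lt_ncard (Set.toFinite _)).mpr
      ⟨f (w 0), hmem 0, f (w 1), hmem 1, hf hadj⟩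
    exact le_antisymm hle hlt
  · rintro ⟨g, hg, hg2⟩
    obtain ⟨a, b, hab, hS⟩ :=
      Set.ncard_eq_two.mp (Set.ncard_compl_eq_two_of_fin_four hg2)
    have hnot : ∀ x (hx : x ∉ Set.range v), x ∈ Γstar → g ⟨x, hx⟩ ≠ a ∧ g ⟨x, hx⟩ ≠ b := by
      intro x hx hxΓ
      have h1 : g ⟨x, hx⟩ ∉ ({a, b} : Set (Fin 4)) := by
        rw [← hS]
        exact fun h ↦ h ⟨⟨x, hx⟩, hxΓ, rfl⟩
      simpa using h1
    classical
    let f : V → Fin 4 := fun x ↦ if hx : x ∈ Set.range v then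
      (if Even (Classical.choose hx).val then a else b) else g ⟨x, hx⟩
    have hfv : ∀ i, f (v i) = if Even i.val then a else b := fun i ↦ by
      have hx : v i ∈ Set.range v := Set.mem_range_self i
      simp only [f, dif_pos hx, hv (Classical.choose_spec hx)]
    have hfout : ∀ x (hx : x ∉ Set.range v), f x = g ⟨x, hx⟩ := fun x hx ↦ dif_neg hx
    have hsucc : ∀ i, f (v i) ≠ f (v (i + 1)) := fun i ↦ by
      have := ZMod.even_val_add_one hm0 i
      rw [hfv, hfv]
      grind
    have hcross : ∀ x i, x ∉ Set.range v → G.Adj x (v i) → f x ≠ f (v i) := by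
      intro x i hx hadj
      have := hnot x hx (hnb x hx ⟨i, hadj⟩)
      rw [hfout x hx, hfv]
      grind
    refine ⟨f, fun x y hxy ↦ ?_, ?_⟩
    · by_cases hx : x ∈ Set.range v <;> by_cases hy : y ∈ Set.range v
      · obtain ⟨i, rfl⟩ := hx
        obtain ⟨j, rfl⟩ := hy
        rcases (hcyc i j).mp hxy with rfl | rfl
        · exact hsucc i
        · exact (hsucc j).symm
      · obtain ⟨i, rfl⟩ := hx
        exact (hcross y i hy hxy.symm).symm
      · obtain ⟨j, rfl⟩ := hy
        exact hcross x j hx hxy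
      · rw [hfout x hx, hfout y hy]
        exact hg hxy
    · rw [Set.ncard_eq_two]
      refine ⟨a, b, hab, ?_⟩
      apply Set.Subset.antisymm
      · rintro _ ⟨_, ⟨i, rfl⟩, rfl⟩
        rw [hfv]
        split_ifs <;> simp
      · rintro c (rfl | rfl)
        · exact ⟨v 0, ⟨0, rfl⟩, by simp [hfv]⟩
        · exact ⟨v 1, ⟨1, rfl⟩, by simp [hfv, ZMod.val_one]⟩
end

section
/- Let G_1 and G_2 be finite simple graphs whose intersection is exactly a path P with at least one edge (that is, V(G_1) ∩ V(G_2) = V(P) and P is a subgraph of both G_1 and G_2), and let G = G_1 ∪ G_2. Suppose that for i = 1, 2, the graph G_i contains a cycle C_i having P as a subpath, and G_i admits a proper 4-coloring f_i in which exactly two colors appear on the vertices of C_i. Then G admits a proper 4-coloring f in which exactly two colors appear on the set V(C_1) ∪ V(C_2). -/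
theorem Equiv.Perm.exists_apply_eq_and_apply_eq {α : Type*} {a b c d : α}
    (hab : a ≠ b) (hcd : c ≠ d) : ∃ σ : Equiv.Perm α, σ a = c ∧ σ b = d := by
  classical
  refine ⟨Equiv.swap (Equiv.swap a c b) d * Equiv.swap a c, ?_, ?_⟩
  · rw [Equiv.Perm.mul_apply, Equiv.swap_apply_left]
    refine Equiv.swap_apply_of_ne_of_ne (fun h => hab ?_) hcd
    exact (Equiv.swap a c).injective ((Equiv.swap_apply_left a c).trans h)
  · rw [Equiv.Perm.mul_apply, Equiv.swap_apply_left]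

theorem Set.eq_or_eq_of_ncard_eq_two {α : Type*} {s : Set α} (hs : s.ncard = 2) {x y z : α}
    (hx : x ∈ s) (hy : y ∈ s) (hxy : x ≠ y) (hz : z ∈ s) : z = x ∨ z = y := by
  obtain ⟨u, v, -, rfl⟩ := Set.ncard_eq_two.mp hs
  simp only [Set.mem_insert_iff, Set.mem_singleton_iff] at hx hy hz
  grind

theorem SimpleGraph.Walk.mem_of_mem_support {V : Type*} {G : SimpleGraph V} {S : Set V}
    (hS : ∀ ⦃a b : V⦄, G.Adj a b → a ∈ S ∧ b ∈ S) {u v : V} (w : G.Walk u v) (hu : u ∈ S)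
    {x : V} (hx : x ∈ w.support) : x ∈ S := by
  induction w with
  | nil => simp_all
  | cons h w ih =>
    rcases List.mem_cons.mp (SimpleGraph.Walk.support_cons h w ▸ hx) with rfl | hx
    · exact hu
    · exact ih (hS h).2 hx

/-- Two sequences that each alternate within the same pair of values agree
if their first terms agree. -/
theorem Fin.eq_of_alternating {α : Type*} {p : ℕ} {c d : α} {g h : Fin (p + 1) → α}
    (hg : ∀ i, g i = c ∨ g i = d) (hh : ∀ i, h i = c ∨ h i = d)
    (hg' : ∀ i : Fin p, g i.castSucc ≠ g i.succ) (hh' : ∀ i : Fin p, h i.castSucc ≠ h i.succ)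
    (h0 : g 0 = h 0) (i : Fin (p + 1)) : g i = h i := by
  induction i using Fin.induction with
  | zero => exact h0
  | succ i ih =>
    have h1 := hg i.castSucc
    have h2 := hg i.succ
    have h3 := hh i.succ
    have h4 := hg' i
    have h5 := hh' i
    grind


/-- cycle-spliced operation: Let `G₁, G₂` be graphs on subsets
`V₁, V₂` of a common vertex type whose intersection is exactly a path `P` (given by
the injective `q : Fin (p+1) → V`, `p ≥ 1`) that is a subgraph of both. Suppose for
`i = 1, 2` the graph `Gᵢ` contains a cycle `Cᵢ = Wᵢ.append Rᵢ` having `P` as a subpath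
(`Wᵢ` runs exactly along `P`), and `Gᵢ` has a proper 4-coloring `fᵢ` using exactly two
colors on `Cᵢ`. Then `G₁ ∪ G₂` has a proper 4-coloring using exactly two colors on
`V(C₁) ∪ V(C₂)`. -/
theorem statement11 {V : Type*}
    (G₁ G₂ : SimpleGraph V) (V₁ V₂ : Set V)
    (hG₁ : ∀ ⦃a b : V⦄, G₁.Adj a b → a ∈ V₁ ∧ b ∈ V₁)
    (hG₂ : ∀ ⦃a b : V⦄, G₂.Adj a b → a ∈ V₂ ∧ b ∈ V₂)
    (p : ℕ) (hp : 1 ≤ p) (q : Fin (p + 1) → V) (hq : Function.Injective q)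
    (hinter : V₁ ∩ V₂ = Set.range q)
    (hP₁ : ∀ i : Fin p, G₁.Adj (q i.castSucc) (q i.succ))
    (hP₂ : ∀ i : Fin p, G₂.Adj (q i.castSucc) (q i.succ))
    (W₁ : G₁.Walk (q 0) (q (Fin.last p))) (R₁ : G₁.Walk (q (Fin.last p)) (q 0))
    (hW₁ : W₁.support = List.ofFn q) (hC₁ : (W₁.append R₁).IsCycle)
    (W₂ : G₂.Walk (q 0) (q (Fin.last p))) (R₂ : G₂.Walk (q (Fin.last p)) (q 0))
    (hW₂ : W₂.support = List.ofFn q) (hC₂ : (W₂.append R₂).IsCycle)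
    (f₁ : V → Fin 4) (hf₁ : ∀ ⦃a b : V⦄, G₁.Adj a b → f₁ a ≠ f₁ b)
    (hf₁C : (f₁ '' {x | x ∈ (W₁.append R₁).support}).ncard = 2)
    (f₂ : V → Fin 4) (hf₂ : ∀ ⦃a b : V⦄, G₂.Adj a b → f₂ a ≠ f₂ b)
    (hf₂C : (f₂ '' {x | x ∈ (W₂.append R₂).support}).ncard = 2) :
    ∃ f : V → Fin 4, (∀ ⦃a b : V⦄, (G₁ ⊔ G₂).Adj a b → f a ≠ f b) ∧
      (f '' ({x | x ∈ (W₁.append R₁).support} ∪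
        {x | x ∈ (W₂.append R₂).support})).ncard = 2 := by
  have hadj₁ : G₁.Adj (q 0) (q 1) := by
    obtain ⟨p, rfl⟩ := Nat.exists_eq_add_of_le' hp
    exact hP₁ 0
  have hadj₂ : G₂.Adj (q 0) (q 1) := by
    obtain ⟨p, rfl⟩ := Nat.exists_eq_add_of_le' hp
    exact hP₂ 0
  have hq₁ : ∀ i, q i ∈ (W₁.append R₁).support := fun i =>
    (SimpleGraph.Walk.mem_support_append_iff _ _).mpr (Or.inl (hW₁ ▸ List.mem_ofFn.mpr ⟨i, rfl⟩))
  have hq₂ : ∀ i, q i ∈ (W₂.append R₂).support := fun i =>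
    (SimpleGraph.Walk.mem_support_append_iff _ _).mpr (Or.inl (hW₂ ▸ List.mem_ofFn.mpr ⟨i, rfl⟩))
  have hne₁ := hf₁ hadj₁
  obtain ⟨σ, hσ0, hσ1⟩ :=
    Equiv.Perm.exists_apply_eq_and_apply_eq (hf₂ hadj₂) hne₁
  have hcol₁ : ∀ x ∈ (W₁.append R₁).support, f₁ x = f₁ (q 0) ∨ f₁ x = f₁ (q 1) := fun x hx =>
    Set.eq_or_eq_of_ncard_eq_two hf₁C ⟨_, hq₁ 0, rfl⟩ ⟨_, hq₁ 1, rfl⟩ hne₁ ⟨x, hx, rfl⟩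
  have hcol₂ : ∀ x ∈ (W₂.append R₂).support,
      σ (f₂ x) = f₁ (q 0) ∨ σ (f₂ x) = f₁ (q 1) := fun x hx => by
    rw [← hσ0, ← hσ1, σ.apply_eq_iff_eq, σ.apply_eq_iff_eq]
    exact Set.eq_or_eq_of_ncard_eq_two hf₂C ⟨_, hq₂ 0, rfl⟩ ⟨_, hq₂ 1, rfl⟩ (hf₂ hadj₂)
      ⟨x, hx, rfl⟩
  have hagree : ∀ i, f₁ (q i) = σ (f₂ (q i)) :=
    Fin.eq_of_alternating (fun i => hcol₁ _ (hq₁ i)) (fun i => hcol₂ _ (hq₂ i))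
      (fun i => hf₁ (hP₁ i)) (fun i => σ.injective.ne (hf₂ (hP₂ i))) hσ0.symm
  classical
  let f : V → Fin 4 := fun x => if x ∈ V₁ then f₁ x else σ (f₂ x)
  have hfV₁ : ∀ x ∈ V₁, f x = f₁ x := fun x hx => if_pos hx
  have hfV₂ : ∀ x ∈ V₂, f x = σ (f₂ x) := fun x hx => by
    by_cases hx₁ : x ∈ V₁
    · obtain ⟨i, rfl⟩ : x ∈ Set.range q := hinter ▸ ⟨hx₁, hx⟩
      rw [hfV₁ _ hx₁, hagree]
    · exact if_neg hx₁
  refine ⟨f, ?_, ?_⟩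
  · rintro a b (h | h)
    · rw [hfV₁ a (hG₁ h).1, hfV₁ b (hG₁ h).2]
      exact hf₁ h
    · rw [hfV₂ a (hG₂ h).1, hfV₂ b (hG₂ h).2]
      exact σ.injective.ne (hf₂ h)
  · refine Set.ncard_eq_two.mpr ⟨f₁ (q 0), f₁ (q 1), hne₁, Set.Subset.antisymm ?_ ?_⟩
    · rintro _ ⟨x, hx | hx, rfl⟩
      · rw [hfV₁ x ((W₁.append R₁).mem_of_mem_support hG₁ (hG₁ hadj₁).1 hx)]
        exact hcol₁ x hx
      · rw [hfV₂ x ((W₂.append R₂).mem_of_mem_support hG₂ (hG₂ hadj₂).1 hx)]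
        exact hcol₂ x hx
    · rintro _ (rfl | rfl)
      · exact ⟨q 0, Or.inl (hq₁ 0), hfV₁ _ (hG₁ hadj₁).1⟩
      · exact ⟨q 1, Or.inl (hq₁ 1), hfV₁ _ (hG₁ hadj₁).2⟩
end
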